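/- Let M ⊂ ℝⁿ be a closed subset. Then the set of functions { x ↦ p(x) e^{-|x|²/4} restricted to M : p a real polynomial on ℝⁿ } spans a dense linear subspace, with respect to the supremum norm, of the space C₀(M) of continuous real-valued functions on M vanishing at infinity. -/

import Mathlib

open scoped ZeroAtInfty
open Filter Topology

namespace ZeroAtInftyContinuousMap

variable {X : Type*} [TopologicalSpace X] [T2Space X]

/-- The extension by zero at infinity, as an isometry from `C₀(X, ℝ)` into the continuous functions
on the one-point compactification of `X`. -/
noncomputable def toOnePoint : C₀(X, ℝ) →ₗᵢ[ℝ] C(OnePoint X, ℝ) where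
  toFun f := OnePoint.continuousMapMk f.toContinuousMap 0 <| by
    rw [coclosedCompact_eq_cocompact]
    exact f.zero_at_infty'
  map_add' f g := by
    ext x
    induction x using OnePoint.rec with
    | infty => exact (add_zero (0 : ℝ)).symm
    | coe x => rfl
  map_smul' c f := by
    ext x
    induction x using OnePoint.rec with
    | infty => exact (mul_zero c).symm
    | coe x => rfl
  norm_map' f := by
    rw [← norm_toBCF_eq_norm]
    refine le_antisymm ?_ ?_
    · rw [ContinuousMap.norm_le _ (norm_nonneg _)]
      intro x
      induction x using OnePoint.rec with
      | infty => exact (norm_zero (E := ℝ)).trans_le (norm_nonneg _)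
      | coe x => exact f.toBCF.norm_coe_le_norm x
    · rw [BoundedContinuousFunction.norm_le (norm_nonneg _)]
      intro x
      refine le_of_eq_of_le ?_ (ContinuousMap.norm_coe_le_norm _ (x : OnePoint X))
      rfl

@[simp]
theorem toOnePoint_coe (f : C₀(X, ℝ)) (x : X) : toOnePoint f x = f x := rfl

@[simp]
theorem toOnePoint_infty (f : C₀(X, ℝ)) : toOnePoint f OnePoint.infty = 0 := rfl

theorem toOnePoint_mul (f g : C₀(X, ℝ)) : toOnePoint (f * g) = toOnePoint f * toOnePoint g := by
  ext x
  induction x using OnePoint.rec with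
  | infty => simp
  | coe x => simp

variable [LocallyCompactSpace X]

/-- A variant of the Stone-Weierstrass theorem: a closed subspace of `C₀(X, ℝ)` that has no common
zero and is stable under multiplication by a family of functions which separates the points and has
no common zero is everything. -/
theorem eq_top_of_isClosed_of_mul_mem {W : Submodule ℝ C₀(X, ℝ)} (hW : IsClosed (W : Set C₀(X, ℝ)))
    {S : Set C₀(X, ℝ)} (hmul : ∀ g ∈ S, ∀ f ∈ W, g * f ∈ W)
    (hsep : ∀ x y, (∀ g ∈ S, g x = g y) → x = y) (hS : ∀ x, ∃ g ∈ S, g x ≠ 0)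
    (hW0 : ∀ x, ∃ f ∈ W, f x ≠ 0) : W = ⊤ := by
  set J : Submodule ℝ C(OnePoint X, ℝ) := W.map toOnePoint.toLinearMap with hJ
  have hJc : IsClosed (J : Set C(OnePoint X, ℝ)) :=
    toOnePoint.isometry.isClosedEmbedding.isClosedMap _ hW
  let A : Subalgebra ℝ C(OnePoint X, ℝ) :=
    { carrier := {a | ∀ f ∈ J, a * f ∈ J}
      mul_mem' := fun {a b} ha hb f hf => by
        rw [mul_assoc]
        exact ha _ (hb f hf)
      add_mem' := fun {a b} ha hb f hf => by
        rw [add_mul]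
        exact J.add_mem (ha f hf) (hb f hf)
      algebraMap_mem' := fun r f hf => by
        rw [← Algebra.smul_def]
        exact J.smul_mem r hf }
  have hAc : IsClosed (A : Set C(OnePoint X, ℝ)) := by
    have : (A : Set C(OnePoint X, ℝ)) = ⋂ f ∈ J, (fun a => a * f) ⁻¹' (J : Set _) := by
      ext a
      simp [A]
    rw [this]
    exact isClosed_biInter fun f _ => hJc.preimage (continuous_mul_const f)
  have hSA : ∀ g ∈ S, toOnePoint g ∈ A := by
    rintro g hg _ ⟨f, hf, rfl⟩
    exact ⟨g * f, hmul g hg f hf, toOnePoint_mul g f⟩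
  have hAsep : A.SeparatesPoints := by
    intro x y hxy
    by_contra! h
    have h' : ∀ g ∈ S, toOnePoint g x = toOnePoint g y := fun g hg =>
      h _ ⟨_, hSA g hg, rfl⟩
    induction x using OnePoint.rec with
    | infty =>
      induction y using OnePoint.rec with
      | infty => exact hxy rfl
      | coe y =>
        obtain ⟨g, hg, hgy⟩ := hS y
        exact hgy (h' g hg).symm
    | coe x =>
      induction y using OnePoint.rec with
      | infty =>
        obtain ⟨g, hg, hgx⟩ := hS x
        exact hgx (h' g hg)
      | coe y => exact hxy (congrArg _ (hsep x y h'))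
  have hA : A = ⊤ := by
    rw [← ContinuousMap.subalgebra_topologicalClosure_eq_top_of_separatesPoints A hAsep]
    exact (SetLike.coe_injective hAc.closure_eq).symm
  let I : Ideal C(OnePoint X, ℝ) :=
    { J with
      smul_mem' := fun a f hf => (hA ▸ Algebra.mem_top : a ∈ A) f hf }
  have hI : ContinuousMap.idealOfSet ℝ (ContinuousMap.setOfIdeal I) = I :=
    ContinuousMap.idealOfSet_ofIdeal_isClosed hJc
  refine eq_top_iff.mpr fun f _ => ?_
  have hf : toOnePoint f ∈ I := by
    rw [← hI, ContinuousMap.mem_idealOfSet]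
    intro x hx
    induction x using OnePoint.rec with
    | infty => exact toOnePoint_infty f
    | coe x =>
      obtain ⟨w, hw, hwx⟩ := hW0 x
      exact absurd (ContinuousMap.notMem_setOfIdeal.mp hx (⟨w, hw, rfl⟩ : toOnePoint w ∈ J)) hwx
  obtain ⟨w, hw, hwf⟩ := hf
  exact toOnePoint.injective hwf ▸ hw

end ZeroAtInftyContinuousMap

theorem Real.abs_exp_sub_sum_le (x : ℝ) (N : ℕ) :
    |Real.exp x - ∑ m ∈ Finset.range N, x ^ m / m.factorial| ≤
      (1 / 2) ^ N * Real.exp (2 * |x|) := by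
  have hexp (y : ℝ) : HasSum (fun m : ℕ => y ^ m / m.factorial) (Real.exp y) := by
    rw [Real.exp_eq_exp_ℝ]
    exact NormedSpace.expSeries_div_hasSum_exp y
  have htail := (hasSum_nat_add_iff' N).mpr (hexp x)
  have hmajor := ((hasSum_nat_add_iff' N).mpr (hexp (2 * |x|))).mul_left ((1 / 2) ^ N)
  rw [← htail.tsum_eq, ← Real.norm_eq_abs]
  refine (tsum_of_norm_bounded hmajor fun m => ?_).trans ?_
  · rw [norm_div, norm_pow, Real.norm_eq_abs, Real.norm_natCast, mul_pow, mul_div_assoc,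
      ← mul_assoc]
    refine le_mul_of_one_le_left (by positivity) ?_
    rw [pow_add, mul_left_comm, ← mul_pow]
    norm_num
    exact one_le_pow₀ one_le_two
  · gcongr
    exact sub_le_self _ (Finset.sum_nonneg fun m _ => by positivity)

namespace MvPolynomial

variable {n : ℕ}

theorem exists_abs_eval_le_mul_exp_norm_sq (p : MvPolynomial (Fin n) ℝ) {η : ℝ} (hη : 0 < η) :
    ∃ C : ℝ, 0 ≤ C ∧ ∀ x : EuclideanSpace ℝ (Fin n), |eval x p| ≤ C * Real.exp (η * ‖x‖ ^ 2) := by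
  induction p using MvPolynomial.induction_on generalizing η with
  | C a =>
    refine ⟨|a|, abs_nonneg a, fun x => ?_⟩
    rw [eval_C]
    exact le_mul_of_one_le_right (abs_nonneg a) (Real.one_le_exp (by positivity))
  | add p q hp hq =>
    obtain ⟨C, hC, hp⟩ := hp hη
    obtain ⟨D, hD, hq⟩ := hq hη
    refine ⟨C + D, by positivity, fun x => ?_⟩
    rw [map_add, add_mul]
    exact (abs_add_le _ _).trans (add_le_add (hp x) (hq x))
  | mul_X p i hp =>
    obtain ⟨C, hC, hp⟩ := hp (half_pos hη)
    refine ⟨C * (1 + 2 / η), by positivity, fun x => ?_⟩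
    have hx : |x i| ≤ (1 + 2 / η) * Real.exp (η / 2 * ‖x‖ ^ 2) := by
      have h1 : |x i| ≤ ‖x‖ := PiLp.norm_apply_le x i
      have h2 : ‖x‖ ≤ (1 + 2 / η) * (η / 2 * ‖x‖ ^ 2 + 1) := by
        have : (1 + 2 / η) * (η / 2 * ‖x‖ ^ 2 + 1) =
            η / 2 * ‖x‖ ^ 2 + ‖x‖ ^ 2 + 1 + 2 / η := by
          field_simp
          ring
        have : 0 < 2 / η := by positivity
        nlinarith [sq_nonneg (‖x‖ - 1), mul_nonneg hη.le (sq_nonneg ‖x‖)]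
      exact h1.trans (h2.trans (by gcongr; exact Real.add_one_le_exp _))
    rw [map_mul, eval_X, abs_mul]
    calc |eval x p| * |x i|
        ≤ C * Real.exp (η / 2 * ‖x‖ ^ 2) * ((1 + 2 / η) * Real.exp (η / 2 * ‖x‖ ^ 2)) := by
          gcongr
          exact hp x
      _ = C * (1 + 2 / η) * Real.exp (η * ‖x‖ ^ 2) := by
          rw [mul_mul_mul_comm, ← Real.exp_add]
          ring_nf

theorem tendsto_eval_mul_exp_neg_mul_norm_sq (p : MvPolynomial (Fin n) ℝ) {c : ℝ} (hc : 0 < c) :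
    Tendsto (fun x : EuclideanSpace ℝ (Fin n) => eval x p * Real.exp (-c * ‖x‖ ^ 2))
      (cocompact _) (𝓝 0) := by
  obtain ⟨C, -, hp⟩ := p.exists_abs_eval_le_mul_exp_norm_sq (half_pos hc)
  have hlim : Tendsto (fun x : EuclideanSpace ℝ (Fin n) => C * Real.exp (-(c / 2 * ‖x‖ ^ 2)))
      (cocompact _) (𝓝 0) := by
    rw [← mul_zero C]
    refine (Real.tendsto_exp_neg_atTop_nhds_zero.comp ?_).const_mul C
    exact ((tendsto_pow_atTop two_ne_zero).comp tendsto_norm_cocompact_atTop).const_mul_atTop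
      (half_pos hc)
  refine squeeze_zero_norm (fun x => ?_) hlim
  rw [Real.norm_eq_abs, abs_mul, Real.abs_exp]
  calc |eval x p| * Real.exp (-c * ‖x‖ ^ 2)
      ≤ C * Real.exp (c / 2 * ‖x‖ ^ 2) * Real.exp (-c * ‖x‖ ^ 2) := by
        gcongr
        exact hp x
    _ = C * Real.exp (-(c / 2 * ‖x‖ ^ 2)) := by
        rw [mul_assoc, ← Real.exp_add]
        ring_nf

/-- The restriction to a closed set `M` of the function `x ↦ p(x) e^{-c|x|²}`. -/
noncomputable def mulGaussian {M : Set (EuclideanSpace ℝ (Fin n))} (hM : IsClosed M)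
    {c : ℝ} (hc : 0 < c) (p : MvPolynomial (Fin n) ℝ) : C₀(M, ℝ) where
  toFun x := eval (x : EuclideanSpace ℝ (Fin n)) p *
    Real.exp (-c * ‖(x : EuclideanSpace ℝ (Fin n))‖ ^ 2)
  continuous_toFun := by
    have := p.continuous_eval
    fun_prop
  zero_at_infty' :=
    (p.tendsto_eval_mul_exp_neg_mul_norm_sq hc).comp
      hM.isClosedEmbedding_subtypeVal.tendsto_cocompact

section mulGaussian

variable {M : Set (EuclideanSpace ℝ (Fin n))} (hM : IsClosed M)

theorem mulGaussian_apply {c : ℝ} (hc : 0 < c) (p : MvPolynomial (Fin n) ℝ) (x : M) :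
    mulGaussian hM hc p x = eval (x : EuclideanSpace ℝ (Fin n)) p *
      Real.exp (-c * ‖(x : EuclideanSpace ℝ (Fin n))‖ ^ 2) := rfl

/-- Expanding `e^{-|x|²/16}` in its power series converges uniformly against `p(x) e^{-|x|²/4}`. -/
theorem mulGaussian_five_sixteenths_mem_closure (p : MvPolynomial (Fin n) ℝ) :
    mulGaussian hM (c := 5 / 16) (by norm_num) p ∈
      closure (Set.range (mulGaussian hM (c := 1 / 4) (by norm_num))) := by
  obtain ⟨B, hB, hp⟩ := p.exists_abs_eval_le_mul_exp_norm_sq (η := 1 / 16) (by norm_num)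
  let q (N : ℕ) : MvPolynomial (Fin n) ℝ :=
    p * ∑ m ∈ Finset.range N, C ((m.factorial : ℝ)⁻¹) * (C (-1 / 16) * ∑ i, X i ^ 2) ^ m
  have hq (N : ℕ) (x : EuclideanSpace ℝ (Fin n)) : eval x (q N) = eval x p *
      ∑ m ∈ Finset.range N, (-1 / 16 * ‖x‖ ^ 2) ^ m / m.factorial := by
    simp [q, EuclideanSpace.real_norm_sq_eq, div_eq_inv_mul]
  have hlim : Tendsto (fun N : ℕ => B * (1 / 2 : ℝ) ^ N) atTop (𝓝 0) := by
    simpa using (tendsto_pow_atTop_nhds_zero_of_lt_one (r := (1 / 2 : ℝ))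
      (by norm_num) (by norm_num)).const_mul B
  refine mem_closure_of_tendsto (f := fun N => mulGaussian hM _ (q N)) (b := atTop) ?_
    (Eventually.of_forall fun N => Set.mem_range_self _)
  refine tendsto_iff_dist_tendsto_zero.mpr
    (squeeze_zero (fun _ => dist_nonneg) (fun N => ?_) hlim)
  rw [← ZeroAtInftyContinuousMap.dist_toBCF_eq_dist,
    BoundedContinuousFunction.dist_le (by positivity)]
  rintro ⟨x, hx⟩
  change dist (eval x (q N) * Real.exp (-(1 / 4) * ‖x‖ ^ 2))
    (eval x p * Real.exp (-(5 / 16) * ‖x‖ ^ 2)) ≤ _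
  rw [dist_comm, Real.dist_eq, hq]
  have hsplit : Real.exp (-(5 / 16) * ‖x‖ ^ 2) =
      Real.exp (-1 / 16 * ‖x‖ ^ 2) * Real.exp (-(1 / 4) * ‖x‖ ^ 2) := by
    rw [← Real.exp_add]
    ring_nf
  have habs : |(-1 / 16 * ‖x‖ ^ 2)| = 1 / 16 * ‖x‖ ^ 2 := by
    rw [abs_mul, abs_of_nonneg (sq_nonneg ‖x‖)]
    norm_num [abs_div]
  have htaylor := Real.abs_exp_sub_sum_le (-1 / 16 * ‖x‖ ^ 2) N
  rw [habs] at htaylor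
  rw [hsplit, ← mul_assoc, ← sub_mul, ← mul_sub, abs_mul, abs_mul, Real.abs_exp]
  calc _ ≤ B * Real.exp (1 / 16 * ‖x‖ ^ 2) *
        ((1 / 2) ^ N * Real.exp (2 * (1 / 16 * ‖x‖ ^ 2))) * Real.exp (-(1 / 4) * ‖x‖ ^ 2) := by
        gcongr
        exact hp x
    _ = B * (1 / 2) ^ N * Real.exp (-(1 / 16 * ‖x‖ ^ 2)) := by
        rw [mul_mul_mul_comm, mul_assoc, ← Real.exp_add, ← Real.exp_add]
        ring_nf
    _ ≤ B * (1 / 2) ^ N :=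
        mul_le_of_le_one_right (by positivity) (Real.exp_le_one_iff.mpr (by
          rw [neg_nonpos]
          positivity))

end mulGaussian

end MvPolynomial


/-- For a closed subset `M ⊂ ℝⁿ`, the restrictions to `M` of the functions
`x ↦ p(x) e^{-|x|²/4}`, `p` a real polynomial on `ℝⁿ`, span a dense linear subspace of
the space `C₀(M)` of continuous functions on `M` vanishing at infinity. -/
theorem polynomial_gaussian_quarter_span_dense_in_C0
    (n : ℕ) (M : Set (EuclideanSpace ℝ (Fin n))) (hM : IsClosed M) :
    Dense ((Submodule.span ℝ
        {f : C₀(M, ℝ) | ∃ p : MvPolynomial (Fin n) ℝ,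
          ∀ x : M, f x = MvPolynomial.eval (x : EuclideanSpace ℝ (Fin n)) p *
            Real.exp (-‖(x : EuclideanSpace ℝ (Fin n))‖ ^ 2 / 4)} :
      Submodule ℝ C₀(M, ℝ)) : Set C₀(M, ℝ)) := by
  set G := {f : C₀(M, ℝ) | ∃ p : MvPolynomial (Fin n) ℝ,
    ∀ x : M, f x = MvPolynomial.eval (x : EuclideanSpace ℝ (Fin n)) p *
      Real.exp (-‖(x : EuclideanSpace ℝ (Fin n))‖ ^ 2 / 4)} with hG
  have hGrange : G = Set.range (MvPolynomial.mulGaussian hM (c := 1 / 4) (by norm_num)) := by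
    have hexp (x : M) : -‖(x : EuclideanSpace ℝ (Fin n))‖ ^ 2 / 4 =
        -(1 / 4) * ‖(x : EuclideanSpace ℝ (Fin n))‖ ^ 2 := by ring
    ext f
    simp only [hG, Set.mem_ofPred, Set.mem_range, hexp]
    exact exists_congr fun p =>
      ⟨fun h => ZeroAtInftyContinuousMap.ext fun x => (h x).symm, by rintro rfl x; rfl⟩
  have : LocallyCompactSpace M := hM.locallyCompactSpace
  set W := (Submodule.span ℝ G).topologicalClosure with hW
  have hGW : closure G ⊆ W := closure_mono Submodule.subset_span
  rw [Submodule.dense_iff_topologicalClosure_eq_top]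
  refine ZeroAtInftyContinuousMap.eq_top_of_isClosed_of_mul_mem
    (Submodule.isClosed_topologicalClosure _)
    (S := Set.range (MvPolynomial.mulGaussian hM (c := 1 / 16) (by norm_num))) ?_ ?_ ?_ ?_
  · rintro _ ⟨q, rfl⟩ f hf
    set g := MvPolynomial.mulGaussian hM (c := 1 / 16) (by norm_num) q with hg
    suffices h : Submodule.span ℝ G ≤ W.comap (LinearMap.mulLeft ℝ g) from
      Submodule.topologicalClosure_minimal _ h
        ((Submodule.isClosed_topologicalClosure _).preimage (continuous_const_mul g)) hf
    rw [Submodule.span_le, hGrange]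
    rintro _ ⟨p, rfl⟩
    refine hGW ?_
    rw [hGrange]
    convert MvPolynomial.mulGaussian_five_sixteenths_mem_closure hM (q * p)
    ext x
    simp only [hg, LinearMap.mulLeft_apply, ZeroAtInftyContinuousMap.mul_apply,
      MvPolynomial.mulGaussian_apply, map_mul]
    rw [mul_mul_mul_comm, ← Real.exp_add]
    ring_nf
  · intro x y h
    have h1 := h _ ⟨1, rfl⟩
    simp only [MvPolynomial.mulGaussian_apply, map_one, one_mul] at h1
    ext i
    have hi := h _ ⟨MvPolynomial.X i, rfl⟩
    simp only [MvPolynomial.mulGaussian_apply, MvPolynomial.eval_X, h1] at hi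
    exact mul_right_cancel₀ (Real.exp_ne_zero _) hi
  · refine fun x => ⟨_, ⟨1, rfl⟩, ?_⟩
    simp [MvPolynomial.mulGaussian_apply]
  · refine fun x => ⟨MvPolynomial.mulGaussian hM (c := 1 / 4) (by norm_num) 1,
      hGW (subset_closure (hGrange ▸ Set.mem_range_self _)), ?_⟩
    simp [MvPolynomial.mulGaussian_apply]
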